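/- Let {X_n} be a stationary and ergodic time series with values in a finite or countably infinite set 𝒳, let H be real, ε₁ > 0, and fix k ≥ 1 and a string y_{−l_k+1}^0 ∈ 𝒳^{l_k}. Then P(X_{−∞}^∞ ∈ Υ_k(y_{−l_k+1}^0)) ≤ (k+1) / 2^{l_k(H+ε₁)}, where Υ_k(y_{−l_k+1}^0) = { z_{−∞}^∞ : −ζ̂_k^k(z_{−∞}^0) ≥ 2^{l_k(H+ε₁)} and z_{−l_k+1}^0 = y_{−l_k+1}^0 }. -/

import Mathlib

open MeasureTheory Filter Set
open scoped ENNReal Topology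

noncomputable section

namespace MWPrediction

/-- The canonical two-sided path space for a process with values in `𝒳`. -/
abbrev Path (𝒳 : Type*) := ℤ → 𝒳

variable {𝒳 : Type*}

/-- The left shift `(T ω) i = ω (i+1)` on two-sided sequences. -/
def shift (ω : Path 𝒳) : Path 𝒳 := fun i => ω (i + 1)

/-- The one-sided past `X⁰_{-∞}`, recorded as `past ω i = X_{-i}`. -/
def past (ω : Path 𝒳) : ℕ → 𝒳 := fun i => ω (-(i : ℤ))

/-- The string `s` of length `m` (read right-to-left: `s j` is the symbol at
position `t - j`) occurs in `ω` ending at time `t`. -/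
def OccursAt (ω : Path 𝒳) (m : ℕ) (s : ℕ → 𝒳) (t : ℤ) : Prop :=
  ∀ j < m, ω (t - (j : ℤ)) = s j

/-- The auxiliary stopping times `ζ_n`:  `ζ_0 = 0` and `ζ_n` is obtained from
`ζ_{n-1}` by waiting for the recurrence of the block of length `l n` ending
at `ζ_{n-1}`. -/
def zeta (l : ℕ → ℕ) (ω : Path 𝒳) : ℕ → ℤ
  | 0 => 0
  | n + 1 =>
    zeta l ω n +
      ((sInf {t : ℕ | 0 < t ∧ ∀ s < l (n + 1),
          ω (zeta l ω n - (s : ℤ) + (t : ℤ)) = ω (zeta l ω n - (s : ℤ))} : ℕ) : ℤ)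

/-- `J n = min { j ≥ 1 : l (j+1) > n }`. -/
def Jfun (l : ℕ → ℕ) (n : ℕ) : ℕ := sInf {j : ℕ | 1 ≤ j ∧ n < l (j + 1)}

/-- The auxiliary process `X̃`: `tildePast l ω i = X̃_{-i} = X_{ζ_{J(i)} - i}`. -/
def tildePast (l : ℕ → ℕ) (ω : Path 𝒳) : ℕ → 𝒳 :=
  fun i => ω (zeta l ω (Jfun l i) - (i : ℤ))

variable [MeasurableSpace 𝒳]

/-- `pstr μ m s = P(X_{-m+1}^0 = s)`, the probability that the string `s` of
length `m` (read right-to-left) occupies positions `-m+1, …, 0`.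
(So `pstr μ (k+1)` is `p_k` of the paper.) -/
def pstr (μ : Measure (Path 𝒳)) (m : ℕ) (s : ℕ → 𝒳) : ℝ :=
  (μ {ω | ∀ j < m, ω (-(j : ℤ)) = s j}).toReal

/-- `pcond μ m y s = P(X_1 = y | X_{-m+1}^0 = s)`, conditioning on `m` symbols.
(So `pcond μ m` is `p_{m-1}(·|·)` of the paper.) -/
def pcond (μ : Measure (Path 𝒳)) (m : ℕ) (y : 𝒳) (s : ℕ → 𝒳) : ℝ :=
  (μ {ω | ω 1 = y ∧ ∀ j < m, ω (-(j : ℤ)) = s j}).toReal / pstr μ m s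

/-- Append `y` as the new rightmost symbol of the string `s`. -/
def withLast (y : 𝒳) (s : ℕ → 𝒳) : ℕ → 𝒳 := fun j => if j = 0 then y else s (j - 1)

/-- The string which agrees with `b` on its rightmost `k` symbols and continues
to the left with `z`:  this is the string `(z, b_{-k+1}^0)` of the paper. -/
def prependOld (b : ℕ → 𝒳) (k : ℕ) (z : ℕ → 𝒳) : ℕ → 𝒳 :=
  fun j => if j < k then b j else z (j - k)

/-- `K` is a memory bound for the past `b`: for all `i ≥ 1`, `y` and `z ∈ 𝒳^i`,
if `p_{K+i}(z, b_{-K+1}^0, y) > 0` then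
`p_{K-1}(y | b_{-K+1}^0) = p_{K+i-1}(y | z, b_{-K+1}^0)`. -/
def IsMemoryBound (μ : Measure (Path 𝒳)) (b : ℕ → 𝒳) (K : ℕ) : Prop :=
  ∀ i : ℕ, 1 ≤ i → ∀ y : 𝒳, ∀ z : ℕ → 𝒳,
    0 < pstr μ (K + i + 1) (withLast y (prependOld b K z)) →
    pcond μ K y b = pcond μ (K + i) y (prependOld b K z)

/-- The (random) memory length `K(b)` of a one-sided path `b`: the smallest
memory bound, and `∞` if there is none. -/
def memLen (μ : Measure (Path 𝒳)) (b : ℕ → 𝒳) : ℕ∞ :=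
  sInf {n : ℕ∞ | ∃ K : ℕ, n = (K : ℕ∞) ∧ IsMemoryBound μ b K}

/-- `Δ_k(b_{-k+1}^0)`. -/
def Delta (μ : Measure (Path 𝒳)) (k : ℕ) (b : ℕ → 𝒳) : ℝ :=
  sSup {d : ℝ | ∃ i : ℕ, 1 ≤ i ∧ ∃ z : ℕ → 𝒳, ∃ x : 𝒳,
    0 < pstr μ (k + i + 1) (withLast x (prependOld b k z)) ∧
    d = |pcond μ k x b - pcond μ (k + i) x (prependOld b k z)|}

/-- `⌈n/2⌉`. -/
def half (n : ℕ) : ℕ := (n + 1) / 2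

open Classical in
/-- The number of times `t ∈ [a, b]` at which the string `s` of length `m`
occurs in `ω` ending at `t`. -/
def cnt (ω : Path 𝒳) (m : ℕ) (s : ℕ → 𝒳) (a b : ℤ) : ℕ :=
  ((Finset.Icc a b).filter fun t => OccursAt ω m s t).card

/-- Membership in `ℒ_{n,m}^{(1)}`: the string `s` of length `m+1` occurs in
`X_0^{⌈n/2⌉ - 1}`. -/
def inL1 (ω : Path 𝒳) (n m : ℕ) (s : ℕ → 𝒳) : Prop :=
  ∃ t : ℤ, (m : ℤ) ≤ t ∧ t ≤ (half n : ℤ) - 1 ∧ OccursAt ω (m + 1) s t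

/-- Membership in `ℒ_{n,m}^{(2)}`: the string `s` of length `m+1` occurs more
than `n^{1-γ}` times in `X_{⌈n/2⌉}^n`. -/
def inL2 (γ : ℝ) (ω : Path 𝒳) (n m : ℕ) (s : ℕ → 𝒳) : Prop :=
  (n : ℝ) ^ (1 - γ) < (cnt ω (m + 1) s ((half n : ℤ) + (m : ℤ)) (n : ℤ) : ℝ)

/-- Membership in `ℒ_m^n = ℒ_{n,m}^{(1)} ∩ ℒ_{n,m}^{(2)}`. -/
def inL (γ : ℝ) (ω : Path 𝒳) (n m : ℕ) (s : ℕ → 𝒳) : Prop :=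
  inL1 ω n m s ∧ inL2 γ ω n m s

/-- The empirical conditional relative frequency of `x` following the string
`s` of length `m`, computed in the second half `X_{⌈n/2⌉}^n` of the data. -/
def empCond (ω : Path 𝒳) (n m : ℕ) (x : 𝒳) (s : ℕ → 𝒳) : ℝ :=
  (cnt ω (m + 1) (withLast x s) ((half n : ℤ) + (m : ℤ)) (n : ℤ) : ℝ) /
    (cnt ω m s ((half n : ℤ) + (m : ℤ) - 1) ((n : ℤ) - 1) : ℝ)

/-- The empirical statistic `Δ̂_k^n(X̃_{-k+1}^0)`. -/
def hatDelta (γ : ℝ) (l : ℕ → ℕ) (ω : Path 𝒳) (n k : ℕ) : ℝ :=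
  (if zeta l ω (Jfun l k) ≤ (half n : ℤ) - 1 then (1 : ℝ) else 0) *
    sSup {d : ℝ | ∃ i : ℕ, 1 ≤ i ∧ i ≤ n ∧ ∃ z : ℕ → 𝒳, ∃ x : 𝒳,
      inL γ ω n (k + i) (withLast x (prependOld (tildePast l ω) k z)) ∧
      d = |empCond ω n k x (tildePast l ω) -
            empCond ω n (k + i) x (prependOld (tildePast l ω) k z)|}

/-- The order estimate `χ_n`: the smallest `0 ≤ k < n` with `Δ̂_k^n ≤ n^{-β}`
(and `χ_0 = 0`). -/
def chi (β γ : ℝ) (l : ℕ → ℕ) (ω : Path 𝒳) (n : ℕ) : ℕ :=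
  sInf {k : ℕ | k < n ∧ hatDelta γ l ω n k ≤ (n : ℝ) ^ (-β)}

/-- The index `j` with `ζ_j ≤ v < ζ_{j+1}`. -/
def jIndex (l : ℕ → ℕ) (ω : Path 𝒳) (v : ℤ) : ℕ := sInf {j : ℕ | v < zeta l ω (j + 1)}

/-- The stopping times `λ_n`:  `λ_0 = 0` and, if `ζ_j ≤ λ_{n-1} < ζ_{j+1}`,
`λ_n = min { t > λ_{n-1} : X_{t - χ_t + 1}^t = X_{ζ_j - χ_t + 1}^{ζ_j} }`. -/
def lambda (β γ : ℝ) (l : ℕ → ℕ) (ω : Path 𝒳) : ℕ → ℤ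
  | 0 => 0
  | n + 1 =>
    lambda β γ l ω n + 1 +
      ((sInf {s : ℕ |
          ∀ r < chi β γ l ω (lambda β γ l ω n + 1 + (s : ℤ)).toNat,
            ω (lambda β γ l ω n + 1 + (s : ℤ) - (r : ℤ)) =
              ω (zeta l ω (jIndex l ω (lambda β γ l ω n)) - (r : ℤ))} : ℕ) : ℤ)

/-- `κ_n = χ_{λ_n}`. -/
def kappa (β γ : ℝ) (l : ℕ → ℕ) (ω : Path 𝒳) (n : ℕ) : ℕ :=
  chi β γ l ω (lambda β γ l ω n).toNat

/-- The estimator `f_n = (1/n) ∑_{j=0}^{n-1} f(X_{λ_j + 1})`. -/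
def fEst (β γ : ℝ) (l : ℕ → ℕ) (f : 𝒳 → ℝ) (ω : Path 𝒳) (n : ℕ) : ℝ :=
  (1 / (n : ℝ)) * ∑ j ∈ Finset.range n, f (ω (lambda β γ l ω j + 1))

open Classical in
/-- The metric `d*` on one-sided sequences. -/
def dstar (x y : ℕ → 𝒳) : ℝ :=
  ∑' i : ℕ, (2 : ℝ)⁻¹ ^ (i + 1) * (if x i ≠ y i then 1 else 0)

/-- `F` restricted to `C` is continuous with respect to the metric `d*`. -/
def ContinuousOnDstar (F : (ℕ → 𝒳) → ℝ) (C : Set (ℕ → 𝒳)) : Prop :=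
  ∀ x ∈ C, ∀ ε > 0, ∃ δ > 0, ∀ y ∈ C, dstar x y < δ → |F y - F x| < ε

/-- The σ-algebra generated by the one-sided past `X^0_{-∞}`. -/
def pastSigma (𝒳 : Type*) [MeasurableSpace 𝒳] : MeasurableSpace (Path 𝒳) :=
  MeasurableSpace.comap past inferInstance

/-- `F` is a version of the conditional expectation `E(f(X_1) | X^0_{-∞})`. -/
def IsPredictor (μ : Measure (Path 𝒳)) (f : 𝒳 → ℝ) (F : (ℕ → 𝒳) → ℝ) : Prop :=
  (fun ω => F (past ω)) =ᵐ[μ] μ[fun ω => f (ω 1)|pastSigma 𝒳]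

/-- `F` (a version of `E(f(X_1)|X^0_{-∞})`) is almost surely continuous:
it is continuous w.r.t. `d*` on a set of paths of probability one. -/
def ASContinuousCondExp (μ : Measure (Path 𝒳)) (F : (ℕ → 𝒳) → ℝ) : Prop :=
  ∃ C : Set (ℕ → 𝒳), μ (past ⁻¹' C) = 1 ∧ ContinuousOnDstar F C

/-- The observation `(λ_j, X_0^{λ_j})`, encoding the data segment available at
time `λ_j` (values before time `0` are clamped to `X_0`). -/
def segObs (β γ : ℝ) (l : ℕ → ℕ) (j : ℕ) (ω : Path 𝒳) : ℤ × (ℕ → 𝒳) :=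
  (lambda β γ l ω j, fun i => ω (max (lambda β γ l ω j - (i : ℤ)) 0))

/-- The σ-algebra generated by `(λ_j, X_0^{λ_j})`. -/
def segSigma (β γ : ℝ) (l : ℕ → ℕ) (j : ℕ) : MeasurableSpace (Path 𝒳) :=
  MeasurableSpace.comap (segObs β γ l j) inferInstance

/-- The observation `(λ_j, X_{-∞}^{λ_j})`: the full past at time `λ_j`. -/
def fullPastObs (β γ : ℝ) (l : ℕ → ℕ) (j : ℕ) (ω : Path 𝒳) : ℤ × (ℕ → 𝒳) :=
  (lambda β γ l ω j, fun i => ω (lambda β γ l ω j - (i : ℤ)))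

/-- The σ-algebra generated by `(λ_j, X_{-∞}^{λ_j})`. -/
def fullPastSigma (β γ : ℝ) (l : ℕ → ℕ) (j : ℕ) : MeasurableSpace (Path 𝒳) :=
  MeasurableSpace.comap (fullPastObs β γ l j) inferInstance

/-- The `n`-th term `-(1/(n+1)) ∑ p log₂ p` of the entropy rate. -/
def entropyTerm (μ : Measure (Path 𝒳)) (n : ℕ) : ℝ :=
  -(1 / ((n : ℝ) + 1)) *
    ∑' s : Fin (n + 1) → 𝒳,
      pstr μ (n + 1) (fun j => if h : j < n + 1 then s ⟨j, h⟩ else s ⟨0, Nat.succ_pos n⟩) *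
        Real.logb 2
          (pstr μ (n + 1) (fun j => if h : j < n + 1 then s ⟨j, h⟩ else s ⟨0, Nat.succ_pos n⟩))

/-- The process has entropy rate `H`. -/
def HasEntropyRate (μ : Measure (Path 𝒳)) (H : ℝ) : Prop :=
  Tendsto (entropyTerm μ) atTop (nhds H)

/-- The backward stopping times `ζ̂_i^k`. -/
def hatZeta (l : ℕ → ℕ) (k : ℕ) (ω : Path 𝒳) : ℕ → ℤ
  | 0 => 0
  | i + 1 =>
    hatZeta l k ω i -
      ((sInf {t : ℕ | 0 < t ∧ ∀ s < l (k - i),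
          ω (hatZeta l k ω i - (s : ℤ) - (t : ℤ)) = ω (hatZeta l k ω i - (s : ℤ))} : ℕ) : ℤ)


/-- The current position of the backward search always carries a suffix of the string at time `0`. -/
lemma occursAt_hatZeta {𝒳 : Type*} {l : ℕ → ℕ} (hl : Monotone l) {k : ℕ} {y : ℕ → 𝒳}
    {ω : Path 𝒳} (h : OccursAt ω (l k) y 0) (i : ℕ) : OccursAt ω (l (k - i)) y (hatZeta l k ω i) := by
  induction i with
  | zero => exact h
  | succ i ih =>
    intro j hj
    have hj' : j < l (k - i) := hj.trans_le (hl (by omega))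
    rw [hatZeta]
    set S := {t : ℕ | 0 < t ∧ ∀ s < l (k - i),
      ω (hatZeta l k ω i - (s : ℤ) - (t : ℤ)) = ω (hatZeta l k ω i - (s : ℤ))}
    rcases S.eq_empty_or_nonempty with he | hne
    · simpa [he] using ih j hj'
    · have := (Nat.sInf_mem hne).2 j hj'
      rw [sub_right_comm, this]
      exact ih j hj'

lemma hatZeta_nonpos {𝒳 : Type*} (l : ℕ → ℕ) (k : ℕ) (ω : Path 𝒳) (i : ℕ) : hatZeta l k ω i ≤ 0 := by
  induction i with
  | zero => exact le_rfl
  | succ i ih => rw [hatZeta]; omega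

/-- At most `i` occurrences of the string at time `0` are passed in `i` backward search steps. -/
lemma cnt_hatZeta_le {𝒳 : Type*} {l : ℕ → ℕ} (hl : Monotone l) {k : ℕ} {y : ℕ → 𝒳}
    {ω : Path 𝒳} (h : OccursAt ω (l k) y 0) (i : ℕ) : cnt ω (l k) y (hatZeta l k ω i + 1) 0 ≤ i := by
  classical
  induction i with
  | zero => simp [cnt, hatZeta]
  | succ i ih =>
    refine le_trans ?_ (Nat.succ_le_succ ih)
    unfold cnt
    refine (Finset.card_le_card ?_).trans (Finset.card_insert_le (hatZeta l k ω i) _)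
    intro t ht
    simp only [Finset.mem_filter, Finset.mem_Icc, Finset.mem_insert] at ht ⊢
    obtain ⟨⟨h1, h2⟩, h3⟩ := ht
    by_contra! hcon
    obtain ⟨hne, hcon⟩ := hcon
    have hlt : t < hatZeta l k ω i := by
      by_contra! hge
      exact hcon ⟨by omega, h2⟩ h3
    obtain ⟨u, hu⟩ := Int.eq_ofNat_of_zero_le (sub_nonneg.2 hlt.le)
    rw [hatZeta] at h1
    set S := {t : ℕ | 0 < t ∧ ∀ s < l (k - i),
      ω (hatZeta l k ω i - (s : ℤ) - (t : ℤ)) = ω (hatZeta l k ω i - (s : ℤ))}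
    have hu' : u < sInf S := by omega
    refine Nat.notMem_of_lt_sInf hu' ⟨by omega, fun s hs => ?_⟩
    rw [occursAt_hatZeta hl h i s hs, ← h3 s (hs.trans_le (hl (by omega)))]
    congr 1
    omega

lemma cnt_anti_left {𝒳 : Type*} (ω : Path 𝒳) (m : ℕ) (s : ℕ → 𝒳) {a a' : ℤ} (h : a ≤ a') (b : ℤ) :
    cnt ω m s a' b ≤ cnt ω m s a b := by
  classical
  exact Finset.card_le_card (Finset.filter_subset_filter _ (Finset.Icc_subset_Icc_left h))

lemma shift_iterate_apply {𝒳 : Type*} (n : ℕ) (ω : Path 𝒳) (i : ℤ) :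
    (shift^[n] ω) i = ω (i + n) := by
  induction n generalizing i with
  | zero => simp
  | succ n ih =>
    rw [Function.iterate_succ_apply', shift, ih]
    push_cast
    congr 1
    ring

lemma occursAt_shift_iterate {𝒳 : Type*} (n : ℕ) (ω : Path 𝒳) (m : ℕ) (s : ℕ → 𝒳) (t : ℤ) :
    OccursAt (shift^[n] ω) m s t ↔ OccursAt ω m s (t + n) := by
  simp only [OccursAt, shift_iterate_apply, sub_add_eq_add_sub]

lemma cnt_shift_iterate {𝒳 : Type*} (n : ℕ) (ω : Path 𝒳) (m : ℕ) (s : ℕ → 𝒳) (a b : ℤ) :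
    cnt (shift^[n] ω) m s a b = cnt ω m s (a + n) (b + n) := by
  classical
  unfold cnt
  refine Finset.card_bij (fun t _ => t + n) ?_ ?_ ?_
  · intro t ht
    simp only [Finset.mem_filter, Finset.mem_Icc, occursAt_shift_iterate] at ht ⊢
    exact ⟨by omega, ht.2⟩
  · intro t _ u _ h
    simpa using h
  · intro t ht
    simp only [Finset.mem_filter, Finset.mem_Icc, occursAt_shift_iterate] at ht ⊢
    exact ⟨t - n, ⟨by omega, by simpa using ht.2⟩, by simp⟩

lemma measurableSet_occursAt [MeasurableSingletonClass 𝒳] (m : ℕ) (s : ℕ → 𝒳) (t : ℤ) :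
    MeasurableSet {ω : Path 𝒳 | OccursAt ω m s t} := by
  simp only [OccursAt, ofPred_forall]
  exact MeasurableSet.iInter fun j => MeasurableSet.iInter fun _ =>
    (measurableSet_singleton (s j)).preimage (measurable_pi_apply (t - (j : ℤ)))

lemma measurable_cnt [MeasurableSingletonClass 𝒳] (m : ℕ) (s : ℕ → 𝒳) (a b : ℤ) :
    Measurable fun ω : Path 𝒳 => cnt ω m s a b := by
  classical
  simp only [cnt, Finset.card_filter]
  exact Finset.measurable_fun_sum _ fun t _ =>
    Measurable.ite (measurableSet_occursAt m s t) measurable_const measurable_const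

/-- Occurrences of a string which are preceded by few others are themselves few:
a window of length `M` contains at most `k` times at which the string occurs for at most the
`k`-th time within the last `M` time steps. -/
lemma card_filter_cnt_le {𝒳 : Type*} (ω : Path 𝒳) (m : ℕ) (s : ℕ → 𝒳) (M k : ℕ)
    [DecidablePred fun n : ℕ => OccursAt ω m s n ∧ cnt ω m s (n - M + 1) n ≤ k] :
    ((Finset.range M).filter fun n : ℕ =>
      OccursAt ω m s n ∧ cnt ω m s (n - M + 1) n ≤ k).card ≤ k := by
  classical
  set F := (Finset.range M).filter fun n : ℕ =>
    OccursAt ω m s n ∧ cnt ω m s (n - M + 1) n ≤ k with hF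
  rcases F.eq_empty_or_nonempty with he | hne
  · simp [he]
  have hmax := F.max'_mem hne
  simp only [hF, Finset.mem_filter, Finset.mem_range] at hmax
  refine le_trans ?_ hmax.2.2
  refine Finset.card_le_card_of_injOn (fun n : ℕ => (n : ℤ)) ?_ Nat.cast_injective.injOn
  intro n hn
  have hle := F.le_max' n hn
  simp only [hF, Finset.coe_filter, Finset.mem_range, mem_ofPred_eq, Finset.mem_Icc] at hn hle ⊢
  exact ⟨by omega, hn.2.1⟩

/-- In a stationary process, the probability that a string occurs at time `0` and at most `k`
times within the last `M` time steps is at most `k / M`. -/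
lemma mul_measure_cnt_le [MeasurableSingletonClass 𝒳] {μ : Measure (Path 𝒳)}
    [IsProbabilityMeasure μ] (hμ : MeasurePreserving (shift : Path 𝒳 → Path 𝒳) μ μ)
    (m : ℕ) (s : ℕ → 𝒳) (M k : ℕ) :
    M * μ {ω | OccursAt ω m s 0 ∧ cnt ω m s (-M + 1) 0 ≤ k} ≤ k := by
  classical
  set A := {ω : Path 𝒳 | OccursAt ω m s 0 ∧ cnt ω m s (-M + 1) 0 ≤ k} with hA
  have hAm : MeasurableSet A :=
    (measurableSet_occursAt m s 0).inter (measurable_cnt m s _ _ measurableSet_Iic)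
  have hmem (n : ℕ) (ω : Path 𝒳) :
      shift^[n] ω ∈ A ↔ OccursAt ω m s n ∧ cnt ω m s (n - M + 1) n ≤ k := by
    rw [hA, mem_ofPred_eq, occursAt_shift_iterate, cnt_shift_iterate, zero_add,
      show (-(M : ℤ) + 1 + n) = n - M + 1 by ring]
  calc M * μ A = ∑ n ∈ Finset.range M, μ (shift^[n] ⁻¹' A) := by
        simp [(hμ.iterate _).measure_preimage hAm.nullMeasurableSet]
    _ = ∑ n ∈ Finset.range M, ∫⁻ ω, (shift^[n] ⁻¹' A).indicator 1 ω ∂μ := by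
        refine Finset.sum_congr rfl fun n _ => ?_
        rw [lintegral_indicator_one ((hμ.iterate n).measurable hAm)]
    _ = ∫⁻ ω, ∑ n ∈ Finset.range M, (shift^[n] ⁻¹' A).indicator 1 ω ∂μ :=
        (lintegral_finsetSum _ fun n _ =>
          measurable_one.indicator ((hμ.iterate n).measurable hAm)).symm
    _ ≤ ∫⁻ _, (k : ℝ≥0∞) ∂μ := by
        refine lintegral_mono fun ω => ?_
        have := card_filter_cnt_le ω m s M k
        simp only [indicator_apply, mem_preimage, hmem, Pi.one_apply, Finset.sum_boole]
        exact_mod_cast this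
    _ = k := by simp

/-- frequency bound from Step 4. For any `H`, `ε₁ > 0`,
`k ≥ 1` and string `y` of length `l k`,
`P(X ∈ Υ_k(y)) ≤ (k+1) / 2^{l_k (H+ε₁)}`. -/
theorem statement11
    {𝒳 : Type*} [Countable 𝒳] [MeasurableSpace 𝒳] [MeasurableSingletonClass 𝒳]
    (μ : Measure (Path 𝒳)) [IsProbabilityMeasure μ]
    (hErg : Ergodic (shift : Path 𝒳 → Path 𝒳) μ)
    (l : ℕ → ℕ) (hl1 : l 1 = 1) (hlmono : Monotone l)
    (hlle : ∀ k, 1 ≤ k → l k ≤ k) (hltop : Tendsto l atTop atTop)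
    (H : ℝ) (ε₁ : ℝ) (hε₁ : 0 < ε₁) (k : ℕ) (hk : 1 ≤ k) (y : ℕ → 𝒳) :
    μ {ω | (2 : ℝ) ^ ((l k : ℝ) * (H + ε₁)) ≤ -(hatZeta l k ω k : ℝ) ∧
        ∀ j < l k, ω (-(j : ℤ)) = y j} ≤
      ENNReal.ofReal (((k : ℝ) + 1) / (2 : ℝ) ^ ((l k : ℝ) * (H + ε₁))) := by
  set N : ℝ := (2 : ℝ) ^ ((l k : ℝ) * (H + ε₁)) with hN
  have hNpos : 0 < N := by positivity
  have hM : N ≤ (⌈N⌉₊ : ℝ) := Nat.le_ceil N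
  have hsub : {ω : Path 𝒳 | N ≤ -(hatZeta l k ω k : ℝ) ∧ ∀ j < l k, ω (-(j : ℤ)) = y j} ⊆
      {ω | OccursAt ω (l k) y 0 ∧ cnt ω (l k) y (-⌈N⌉₊ + 1) 0 ≤ k} := by
    rintro ω ⟨hζ, hy⟩
    have h0 : OccursAt ω (l k) y 0 := fun j hj => by simpa using hy j hj
    refine ⟨h0, (cnt_anti_left ω _ _ ?_ _).trans (cnt_hatZeta_le hlmono h0 k)⟩
    have hζ' : N ≤ ((-hatZeta l k ω k).toNat : ℝ) := by
      have hcast : ((-hatZeta l k ω k).toNat : ℤ) = -hatZeta l k ω k :=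
        Int.toNat_of_nonneg (neg_nonneg.2 (hatZeta_nonpos l k ω k))
      rw [← Int.cast_natCast, hcast]
      exact_mod_cast hζ
    have := Nat.ceil_le.2 hζ'
    have := hatZeta_nonpos l k ω k
    omega
  refine (measure_mono hsub).trans ?_
  rw [ENNReal.ofReal_div_of_pos hNpos, ENNReal.le_div_iff_mul_le
    (Or.inl (ENNReal.ofReal_pos.2 hNpos).ne') (Or.inl ENNReal.ofReal_ne_top), mul_comm]
  calc ENNReal.ofReal N * μ {ω | OccursAt ω (l k) y 0 ∧ cnt ω (l k) y (-⌈N⌉₊ + 1) 0 ≤ k}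
      ≤ ⌈N⌉₊ * μ {ω | OccursAt ω (l k) y 0 ∧ cnt ω (l k) y (-⌈N⌉₊ + 1) 0 ≤ k} := by
        gcongr
        exact ENNReal.ofReal_le_of_le_toReal (by simpa using hM)
    _ ≤ k := mul_measure_cnt_le hErg.toMeasurePreserving _ _ _ _
    _ ≤ ENNReal.ofReal ((k : ℝ) + 1) := by
        rw [← ENNReal.ofReal_natCast k]
        exact ENNReal.ofReal_le_ofReal (by linarith)

end MWPrediction
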